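/- arXiv:1705.05985 — 2 statements merged into one kernel-verified Lean document; each statement's English description precedes it below -/
import Mathlib

section
/- Let V be a type, o : V a distinguished element, and B : V → V → Prop a relation, and let dB : V → ℕ∞ denote the B-distance to o. If a function f : V → ℕ∞ satisfies f o = 0 and, for every v ≠ o, f v = 1 + ⨅ w ∈ {w | B v w}, f w (infimum in ℕ∞), then f = dB; that is, the recursion f(o) = 0, f(v) = 1 + min over B-successors determines a unique function, namely the B-distance to o. -/
/-- `IsPathLen B o v n` says there is a `B`-path of length `n` from `v` to `o`,
i.e. a sequence `v = v₀, v₁, …, vₙ = o` with `B vᵢ vᵢ₊₁` for all `i < n`. -/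
def IsPathLen {V : Type*} (B : V → V → Prop) (o v : V) (n : ℕ) : Prop :=
  ∃ f : ℕ → V, f 0 = v ∧ f n = o ∧ ∀ i < n, B (f i) (f (i + 1))

/-- The `B`-distance from `v` to `o`: the infimum in `ℕ∞` of the lengths of all
`B`-paths from `v` to `o` (equal to `⊤` if there is no such path). -/
noncomputable def distTo {V : Type*} (B : V → V → Prop) (o v : V) : ℕ∞ :=
  ⨅ n ∈ {n : ℕ | IsPathLen B o v n}, (n : ℕ∞)

theorem isPathLen_zero {V : Type*} (B : V → V → Prop) (o : V) : IsPathLen B o o 0 :=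
  ⟨fun _ => o, rfl, rfl, fun _ hi => absurd hi (Nat.not_lt_zero _)⟩

theorem isPathLen_zero_iff {V : Type*} {B : V → V → Prop} {o v : V} :
    IsPathLen B o v 0 ↔ v = o := by
  constructor
  · rintro ⟨p, rfl, hp, -⟩
    exact hp
  · rintro rfl
    exact isPathLen_zero B v

theorem isPathLen_succ_iff {V : Type*} {B : V → V → Prop} {o v : V} {n : ℕ} :
    IsPathLen B o v (n + 1) ↔ ∃ w, B v w ∧ IsPathLen B o w n := by
  constructor
  · rintro ⟨p, rfl, hn, hp⟩
    exact ⟨p 1, hp 0 n.succ_pos, fun i => p (i + 1), rfl, hn, fun i hi => hp (i + 1) (by lia)⟩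
  · rintro ⟨w, hvw, p, rfl, hn, hp⟩
    refine ⟨fun i => Nat.casesOn i v p, rfl, hn, fun i hi => ?_⟩
    cases i with
    | zero => exact hvw
    | succ i => exact hp i (by lia)

theorem le_of_isPathLen {V : Type*} {o : V} {B : V → V → Prop} {f : V → ℕ∞}
    (h0 : f o = 0) (hle : ∀ v w, v ≠ o → B v w → f v ≤ 1 + f w) {v : V} {n : ℕ}
    (h : IsPathLen B o v n) : f v ≤ n := by
  induction n generalizing v with
  | zero => simp [isPathLen_zero_iff.1 h, h0]
  | succ n ih =>
    obtain ⟨w, hvw, hw⟩ := isPathLen_succ_iff.1 h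
    by_cases hv : v = o
    · simp [hv, h0]
    · calc f v ≤ 1 + f w := hle v w hv hvw
        _ ≤ 1 + n := by gcongr; exact ih hw
        _ = (n + 1 : ℕ) := by push_cast; exact add_comm _ _

theorem exists_isPathLen_of_le {V : Type*} {o : V} {B : V → V → Prop} {f : V → ℕ∞}
    (hge : ∀ v, v ≠ o → 1 + ⨅ w ∈ {w | B v w}, f w ≤ f v) {v : V} {n : ℕ}
    (h : f v ≤ n) : ∃ m ≤ n, IsPathLen B o v m := by
  induction n generalizing v with
  | zero =>
    by_cases hv : v = o
    · exact ⟨0, le_rfl, isPathLen_zero_iff.2 hv⟩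
    · have := (hge v hv).trans h
      simp at this
  | succ n ih =>
    by_cases hv : v = o
    · exact ⟨0, Nat.zero_le _, isPathLen_zero_iff.2 hv⟩
    · have hinf : ⨅ w ∈ {w | B v w}, f w ≤ (n : ℕ∞) := by
        have := (hge v hv).trans h
        rw [Nat.cast_succ, add_comm] at this
        exact (ENat.add_le_add_iff_right ENat.one_ne_top).1 this
      have hlt : ⨅ w ∈ {w | B v w}, f w < (n : ℕ∞) + 1 :=
        hinf.trans_lt (by exact_mod_cast n.lt_succ_self)
      simp only [iInf_lt_iff] at hlt
      obtain ⟨w, hvw, hw⟩ := hlt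
      obtain ⟨m, hm, hp⟩ := ih (Order.le_of_lt_add_one hw)
      exact ⟨m + 1, Nat.succ_le_succ hm, isPathLen_succ_iff.2 ⟨w, hvw, hp⟩⟩

/-- Uniqueness: any `f : V → ℕ∞` with `f o = 0` satisfying the Bellman recursion
`f v = 1 + ⨅ w ∈ {w | B v w}, f w` at every `v ≠ o` equals the `B`-distance to `o`. -/
theorem eq_distTo_of_recursion {V : Type*} (o : V) (B : V → V → Prop) (f : V → ℕ∞)
    (h0 : f o = 0)
    (hrec : ∀ v : V, v ≠ o → f v = 1 + ⨅ w ∈ {w | B v w}, f w) :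
    f = distTo B o := by
  funext v
  apply le_antisymm
  · refine le_iInf₂ fun n hn => le_of_isPathLen h0 (fun v w hv hvw => ?_) hn
    rw [hrec v hv]
    gcongr
    exact iInf₂_le w hvw
  · cases hfv : f v with
    | top => exact le_top
    | coe n =>
      obtain ⟨m, hm, hp⟩ := exists_isPathLen_of_le (fun v hv => (hrec v hv).ge) hfv.le
      exact (iInf₂_le m hp).trans (by exact_mod_cast hm)
end

section
/- Let V be a type, o : V a distinguished element, and A, B : V → V → Prop relations with B ≤ A (i.e., B v w implies A v w for all v, w). Let dA, dB : V → ℕ∞ denote the A-distance and B-distance to o respectively. Then the following are equivalent: (i) for every v ≠ o, dA v = 1 + ⨅ w ∈ {w | B v w}, dA w (infimum in ℕ∞); (ii) dA = dB. -/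
theorem ENat.biInf_le_natCast_iff {ι : Type*} {s : Set ι} {f : ι → ℕ∞} {n : ℕ} :
    ⨅ i ∈ s, f i ≤ (n : ℕ∞) ↔ ∃ i ∈ s, f i ≤ n := by
  refine ⟨fun h => ?_, fun ⟨i, hi, h⟩ => iInf₂_le_of_le i hi h⟩
  have h' : ⨅ i ∈ s, f i < (n : ℕ∞) + 1 :=
    (ENat.lt_add_one_iff (ENat.natCast_ne_top n)).2 h
  simp only [iInf_lt_iff] at h'
  obtain ⟨i, hi, h'⟩ := h'
  exact ⟨i, hi, (ENat.lt_add_one_iff (ENat.natCast_ne_top n)).1 h'⟩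

theorem ENat.le_of_forall_natCast_le {a b : ℕ∞} (h : ∀ n : ℕ, b ≤ n → a ≤ n) : a ≤ b := by
  cases b with
  | top => exact le_top
  | coe n => exact h n le_rfl

section

variable {V : Type*} {A B : V → V → Prop} {o v : V} {n : ℕ}

theorem isPathLen_zero_s6 : IsPathLen B o v 0 ↔ v = o :=
  ⟨fun ⟨_, h0, hn, _⟩ => h0.symm.trans hn, fun h => ⟨fun _ => v, rfl, h, by simp⟩⟩

theorem isPathLen_succ : IsPathLen B o v (n + 1) ↔ ∃ w, B v w ∧ IsPathLen B o w n := by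
  constructor
  · rintro ⟨f, rfl, hn, hf⟩
    exact ⟨f 1, hf 0 n.succ_pos, fun i => f (i + 1), rfl, hn,
      fun i hi => hf (i + 1) (Nat.succ_lt_succ hi)⟩
  · rintro ⟨w, hw, f, rfl, hn, hf⟩
    refine ⟨fun i => Nat.casesOn i v f, rfl, hn, fun i hi => ?_⟩
    cases i with
    | zero => exact hw
    | succ i => exact hf i (Nat.lt_of_succ_lt_succ hi)

theorem distTo_le_natCast_iff : distTo B o v ≤ n ↔ ∃ m ≤ n, IsPathLen B o v m := by
  rw [distTo, ENat.biInf_le_natCast_iff]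
  simp [and_comm]

theorem distTo_anti (h : ∀ v w, B v w → A v w) : distTo A o v ≤ distTo B o v :=
  biInf_mono fun _ ⟨f, h0, hn, hf⟩ => ⟨f, h0, hn, fun i hi => h _ _ (hf i hi)⟩

theorem distTo_le_zero_iff : distTo B o v ≤ (0 : ℕ) ↔ v = o := by
  simp only [distTo_le_natCast_iff, Nat.le_zero, exists_eq_left, isPathLen_zero_s6]

theorem distTo_le_succ_iff (hv : v ≠ o) :
    distTo B o v ≤ (n + 1 : ℕ) ↔ ∃ w, B v w ∧ distTo B o w ≤ n := by
  simp only [distTo_le_natCast_iff]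
  constructor
  · rintro ⟨_ | m, hm, h⟩
    · exact absurd (isPathLen_zero_s6.1 h) hv
    · obtain ⟨w, hw, h⟩ := isPathLen_succ.1 h
      exact ⟨w, hw, m, Nat.le_of_succ_le_succ hm, h⟩
  · rintro ⟨w, hw, m, hm, h⟩
    exact ⟨m + 1, Nat.succ_le_succ hm, isPathLen_succ.2 ⟨w, hw, h⟩⟩

theorem one_add_biInf_le_succ_iff {d : V → ℕ∞} :
    1 + ⨅ w ∈ {w | B v w}, d w ≤ (n + 1 : ℕ) ↔ ∃ w, B v w ∧ d w ≤ n := by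
  rw [Nat.cast_add, Nat.cast_one, add_comm,
    ENat.add_le_add_iff_right ENat.one_ne_top, ENat.biInf_le_natCast_iff]
  rfl

theorem distTo_eq_one_add_biInf (hv : v ≠ o) :
    distTo B o v = 1 + ⨅ w ∈ {w | B v w}, distTo B o w := by
  have key (n : ℕ) :
      distTo B o v ≤ n ↔ 1 + ⨅ w ∈ {w | B v w}, distTo B o w ≤ (n : ℕ∞) := by
    cases n with
    | zero =>
      rw [distTo_le_zero_iff]
      simp [hv]
    | succ n => rw [distTo_le_succ_iff hv, one_add_biInf_le_succ_iff]
  exact le_antisymm (ENat.le_of_forall_natCast_le fun n => (key n).2)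
    (ENat.le_of_forall_natCast_le fun n => (key n).1)

theorem distTo_le_of_recursion {d : V → ℕ∞} (h0 : ∀ v, d v ≤ (0 : ℕ) → v = o)
    (h : ∀ v, v ≠ o → d v = 1 + ⨅ w ∈ {w | B v w}, d w) (v : V) : distTo B o v ≤ d v := by
  refine ENat.le_of_forall_natCast_le fun n => ?_
  induction n generalizing v with
  | zero => exact fun hd => distTo_le_zero_iff.2 (h0 v hd)
  | succ n ih =>
    intro hd
    by_cases hv : v = o
    · exact (distTo_le_zero_iff.2 hv).trans (by simp)
    · rw [h v hv, one_add_biInf_le_succ_iff] at hd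
      obtain ⟨w, hw, hd⟩ := hd
      exact (distTo_le_succ_iff hv).2 ⟨w, hw, ih w hd⟩

end

/-- If `B ≤ A`, then `distTo A o` satisfies the Bellman recursion along `B` at every
`v ≠ o` if and only if `distTo A o = distTo B o`. -/
theorem recursion_iff_distTo_eq {V : Type*} (o : V) (A B : V → V → Prop)
    (hBA : ∀ v w : V, B v w → A v w) :
    (∀ v : V, v ≠ o →
        distTo A o v = 1 + ⨅ w ∈ {w | B v w}, distTo A o w) ↔
      distTo A o = distTo B o := by
  constructor
  · exact fun h => funext fun v => le_antisymm (distTo_anti hBA)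
      (distTo_le_of_recursion (fun _ => distTo_le_zero_iff.1) h v)
  · intro h v hv
    rw [h]
    exact distTo_eq_one_add_biInf hv
end
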